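/- arXiv:2106.07747 — 2 statements merged into one kernel-verified Lean document; each statement's English description precedes it below -/
import Mathlib

section
/- For even k ≥ 4, the Eisenstein series E_k(τ) = -B_k/k! + (2/(k-1)!) Σ_{n≥1} n^{k-1} q^n/(1-q^n) (with q = e^{2πiτ}) satisfies E_k((aτ+b)/(cτ+d)) = (cτ+d)^k E_k(τ) for every matrix [[a,b],[c,d]] in SL₂(ℤ). -/
open Complex

/-- The nome `q = e^{2πiτ}`. -/
noncomputable def nome (τ : ℂ) : ℂ := Complex.exp (2 * Real.pi * I * τ)

/-- The Eisenstein series `E_k(τ) = -B_k/k! + (2/(k-1)!) Σ_{n≥1} n^{k-1} q^n/(1-q^n)`. -/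
noncomputable def Eis (k : ℕ) (τ : ℂ) : ℂ :=
  -(bernoulli k : ℂ) / (Nat.factorial k) +
    (2 / (Nat.factorial (k - 1))) *
      ∑' n : ℕ, ((n : ℂ) + 1) ^ (k - 1) * nome τ ^ (n + 1) / (1 - nome τ ^ (n + 1))

lemma eis_bernoulli_ne_zero (k : ℕ) (hk : Even k) (hk4 : 4 ≤ k) : (bernoulli k : ℂ) ≠ 0 := by
  obtain ⟨m, rfl⟩ := hk
  rw [← two_mul] at *
  intro h
  have h1 := riemannZeta_two_mul_nat (k := m) (by omega)
  rw [h] at h1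
  have h2 : riemannZeta (2 * m : ℂ) ≠ 0 := by
    apply riemannZeta_ne_zero_of_one_lt_re
    have : (1 : ℝ) < 2 * m := by exact_mod_cast (by omega : 1 < 2 * m)
    simpa using this
  exact h2 (by simpa using h1)

lemma Eis_eq_E (k : ℕ) (hk : Even k) (hk4 : 4 ≤ k) (z : UpperHalfPlane) :
    Eis k (z : ℂ) = -(bernoulli k : ℂ) / (Nat.factorial k) *
      ModularForm.E (show 3 ≤ k by omega) z := by
  have hB := eis_bernoulli_ne_zero k hk hk4
  have h1 := tsum_pow_div_one_sub_eq_tsum_sigma (UpperHalfPlane.norm_exp_two_pi_I_lt_one z) (k - 1)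
  rw [tsum_pnat_eq_tsum_succ (f := fun n : ℕ => (n : ℂ) ^ (k - 1) *
    cexp (2 * Real.pi * I * z) ^ n / (1 - cexp (2 * Real.pi * I * z) ^ n))] at h1
  push_cast at h1
  have hf : (Nat.factorial k : ℂ) = k * Nat.factorial (k - 1) := by
    exact_mod_cast (Nat.mul_factorial_pred (by omega)).symm
  have hf0 : (Nat.factorial (k - 1) : ℂ) ≠ 0 := by exact_mod_cast Nat.factorial_ne_zero _
  have hk0 : (k : ℂ) ≠ 0 := by exact_mod_cast (by omega : k ≠ 0)
  rw [EisensteinSeries.q_expansion_bernoulli _ hk, Eis]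
  simp only [nome, zpow_natCast]
  rw [h1, hf]
  field_simp
  ring

/-- For even `k ≥ 4`, `E_k` is modular of weight `k` for `SL₂(ℤ)`:
`E_k((aτ+b)/(cτ+d)) = (cτ+d)^k E_k(τ)`. -/
theorem eisenstein_modular (k : ℕ) (hk : Even k) (hk4 : 4 ≤ k)
    (τ : ℂ) (hτ : 0 < τ.im) (A : Matrix.SpecialLinearGroup (Fin 2) ℤ) :
    Eis k (((A.1 0 0 : ℤ) * τ + (A.1 0 1 : ℤ)) / ((A.1 1 0 : ℤ) * τ + (A.1 1 1 : ℤ)))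
      = ((A.1 1 0 : ℤ) * τ + (A.1 1 1 : ℤ)) ^ k * Eis k τ := by
  let z : UpperHalfPlane := ⟨τ, hτ⟩
  have hz : (z : ℂ) = τ := rfl
  have hs : ((A • z : UpperHalfPlane) : ℂ) = ((A.1 0 0 : ℤ) * τ + (A.1 0 1 : ℤ)) /
      ((A.1 1 0 : ℤ) * τ + (A.1 1 1 : ℤ)) := by
    rw [UpperHalfPlane.coe_specialLinearGroup_apply]
    simp [hz]
  have h := SlashInvariantForm.slash_action_eqn'' (ModularForm.E (show 3 ≤ k by omega))
    (γ := (A : GL (Fin 2) ℝ)) (by exact ⟨A, rfl⟩) z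
  have hd : UpperHalfPlane.denom (A : GL (Fin 2) ℝ) z
      = (A.1 1 0 : ℤ) * τ + (A.1 1 1 : ℤ) := by
    simp [UpperHalfPlane.denom, hz]
  rw [← hs, ← hz, Eis_eq_E k hk hk4, Eis_eq_E k hk hk4, hz, ← hd]
  have hE : ModularForm.E (show 3 ≤ k by omega) (A • z) = _ := h
  rw [hE, zpow_natCast]
  ring
end

section
/- The quasi-modular Eisenstein series E_2 satisfies E_2((aτ+b)/(cτ+d)) = (cτ+d)^2 E_2(τ) - c(cτ+d)/(2πi) for every matrix [[a,b],[c,d]] in SL₂(ℤ). -/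
open Complex

/-- The quasi-modular Eisenstein series
`E_2(τ) = -B_2/2! + 2 Σ_{n≥1} n q^n/(1-q^n)` with `B_2 = 1/6`. -/
noncomputable def EisTwo (τ : ℂ) : ℂ :=
  -(bernoulli 2 : ℂ) / (Nat.factorial 2) +
    2 * ∑' n : ℕ, ((n : ℂ) + 1) * nome τ ^ (n + 1) / (1 - nome τ ^ (n + 1))

lemma eisTwo_eq_E2 (z : UpperHalfPlane) :
    EisTwo (z : ℂ) = -(1 / 12) * EisensteinSeries.E2 z := by
  have h := tsum_pow_div_one_sub_eq_tsum_sigma (UpperHalfPlane.norm_exp_two_pi_I_lt_one z) 1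
  have h2 := tsum_pnat_eq_tsum_succ (f := fun n : ℕ ↦
    (n : ℂ) ^ 1 * cexp (2 * Real.pi * I * z) ^ n / (1 - cexp (2 * Real.pi * I * z) ^ n))
  have h3 := EisensteinSeries.E2_eq_tsum_cexp (z := z)
  rw [h3, ← h, h2]
  simp only [EisTwo, nome, bernoulli_two, pow_one]
  push_cast
  norm_num [Nat.factorial]
  ring

/-- `E_2((aτ+b)/(cτ+d)) = (cτ+d)^2 E_2(τ) - c(cτ+d)/(2πi)` for `[[a,b],[c,d]] ∈ SL₂(ℤ)`. -/
theorem eisenstein_two_quasimodular (τ : ℂ) (hτ : 0 < τ.im)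
    (A : Matrix.SpecialLinearGroup (Fin 2) ℤ) :
    EisTwo (((A.1 0 0 : ℤ) * τ + (A.1 0 1 : ℤ)) / ((A.1 1 0 : ℤ) * τ + (A.1 1 1 : ℤ)))
      = ((A.1 1 0 : ℤ) * τ + (A.1 1 1 : ℤ)) ^ 2 * EisTwo τ
        - (A.1 1 0 : ℤ) * ((A.1 1 0 : ℤ) * τ + (A.1 1 1 : ℤ)) / (2 * Real.pi * I) := by
  have h := congrFun (EisensteinSeries.E2_slash_action A) ⟨τ, hτ⟩
  have hd : UpperHalfPlane.denom (A : Matrix.GeneralLinearGroup (Fin 2) ℝ)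
      ((⟨τ, hτ⟩ : UpperHalfPlane) : ℂ) = (A.1 1 0 : ℤ) * τ + (A.1 1 1 : ℤ) :=
    ModularGroup.denom_apply A ⟨τ, hτ⟩
  have hne := UpperHalfPlane.denom_ne_zero (A : Matrix.GeneralLinearGroup (Fin 2) ℝ) ⟨τ, hτ⟩
  have hs : ((A • (⟨τ, hτ⟩ : UpperHalfPlane) : UpperHalfPlane) : ℂ) =
      ((A.1 0 0 : ℤ) * τ + (A.1 0 1 : ℤ)) / ((A.1 1 0 : ℤ) * τ + (A.1 1 1 : ℤ)) := by
    rw [UpperHalfPlane.coe_specialLinearGroup_apply]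
    simp
  have h0 := eisTwo_eq_E2 ⟨τ, hτ⟩
  rw [← hs, eisTwo_eq_E2]
  simp only [ModularForm.SL_slash_apply, Pi.sub_apply, Pi.smul_apply, EisensteinSeries.D2,
    riemannZeta_two, smul_eq_mul] at h
  rw [hd] at h hne
  change EisTwo τ = _ at h0
  rw [h0]
  set j : ℂ := (A.1 1 0 : ℤ) * τ + (A.1 1 1 : ℤ) with hj
  have hc : ((A 1 0 : ℤ) : ℂ) = (A.1 1 0 : ℤ) := rfl
  rw [hc] at h
  generalize ((A.1 1 0 : ℤ) : ℂ) = c at *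
  generalize EisensteinSeries.E2 (A • (⟨τ, hτ⟩ : UpperHalfPlane)) = X at *
  generalize EisensteinSeries.E2 (⟨τ, hτ⟩ : UpperHalfPlane) = Y at *
  clear_value j
  have hpi : (Real.pi : ℂ) ≠ 0 := by exact_mod_cast Real.pi_ne_zero
  have hX : X = j ^ 2 * (X * j ^ (-2 : ℤ)) := by
    rw [zpow_neg]; field_simp
  rw [hX, h]
  field_simp
  ring_nf
  simp only [I_sq]
  ring
end
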